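/- Let γ ∈ ℝ^d be a probability distribution with rational entries γ_i = c_i/N, where the c_i are positive integers with ∑_i c_i = N, let Γ denote the associated embedding map, and let η_N be the uniform distribution on N outcomes. Let p, q ∈ ℝ^d be probability distributions with D(p‖γ) > 0, D(q‖γ) > 0, V(p‖γ) > 0 and V(q‖γ) > 0. Let (t_n) be a moderate sequence and set ε_n = 1 − e^{−n t_n²}. For ε ≥ 0 define R_n^{th}(ε) = (1/n)·sup{ m ∈ ℕ : (Γp)^{⊗n} ⊗ η_N^{⊗m} ≻_ε (Γq)^{⊗m} ⊗ η_N^{⊗n} }, where ≻_ε is approximate majorisation with total variation error. Set ν = (V(p‖γ)/D(p‖γ)) / (V(q‖γ)/D(q‖γ)). Then lim_{n→∞} ( R_n^{th}(ε_n) − D(p‖γ)/D(q‖γ) ) / t_n = +(√(2 V(p‖γ)) / D(q‖γ)) · (1 + 1/√ν). -/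

import Mathlib

open Finset Filter Real Topology

noncomputable section

/-- A probability distribution on a finite type: nonnegative entries summing to 1. -/
def IsProbDist {α : Type*} [Fintype α] (a : α → ℝ) : Prop :=
  (∀ i, 0 ≤ a i) ∧ ∑ i, a i = 1

/-- A sharp distribution: a single entry equal to 1, all others 0. -/
def IsSharp {α : Type*} [Fintype α] (a : α → ℝ) : Prop :=
  ∃ i, a i = 1 ∧ ∀ j, j ≠ i → a j = 0

/-- The uniform distribution: all entries equal to `1 / |α|`. -/
def IsUniform {α : Type*} [Fintype α] (a : α → ℝ) : Prop :=
  ∀ i, a i = 1 / (Fintype.card α : ℝ)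

/-- Tensor (Kronecker) product of two vectors. -/
def tensor {α β : Type*} (a : α → ℝ) (b : β → ℝ) : α × β → ℝ :=
  fun x => a x.1 * b x.2

/-- `n`-fold tensor power of a vector. -/
def tpow {α : Type*} (a : α → ℝ) (n : ℕ) : (Fin n → α) → ℝ :=
  fun f => ∏ j, a (f j)

/-- Shannon entropy (natural logarithm, with the convention `0 · ln 0 = 0`). -/
def shannonH {α : Type*} [Fintype α] (a : α → ℝ) : ℝ :=
  -∑ i, a i * Real.log (a i)

/-- Entropy variance `V(a) = ∑ i, a i (ln a i + H(a))²`. -/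
def entV {α : Type*} [Fintype α] (a : α → ℝ) : ℝ :=
  ∑ i, a i * (Real.log (a i) + shannonH a) ^ 2

/-- Relative entropy `D(a‖b)`. -/
def relD {α : Type*} [Fintype α] (a b : α → ℝ) : ℝ :=
  ∑ i, a i * Real.log (a i / b i)

/-- Relative entropy variance `V(a‖b)`. -/
def relV {α : Type*} [Fintype α] (a b : α → ℝ) : ℝ :=
  ∑ i, a i * (Real.log (a i / b i) - relD a b) ^ 2

/-- Total variation distance. -/
def tvd {α : Type*} [Fintype α] (a b : α → ℝ) : ℝ :=
  (1 / 2) * ∑ i, |a i - b i|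

/-- Fidelity `F(a,b) = (∑ i √(a i · b i))²`. -/
def fid {α : Type*} [Fintype α] (a b : α → ℝ) : ℝ :=
  (∑ i, Real.sqrt (a i * b i)) ^ 2

/-- The entries of `a` sorted in non-increasing order, as a vector on `Fin (card α)`. -/
def descSorted {α : Type*} [Fintype α] (a : α → ℝ) : Fin (Fintype.card α) → ℝ :=
  fun i =>
    a ((Fintype.equivFin α).symm
      (Tuple.sort (fun j => -a ((Fintype.equivFin α).symm j)) i))

/-- `headSum a K = ∑_{1 ≤ i ≤ K} a^↓_i` (1-based indices `i`, comparison `(i : ℝ) ≤ K`,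
equivalently `i ≤ ⌊K⌋`). -/
def headSum {α : Type*} [Fintype α] (a : α → ℝ) (K : ℝ) : ℝ :=
  ∑ i ∈ Finset.univ.filter (fun i : Fin (Fintype.card α) => ((i : ℕ) + 1 : ℝ) ≤ K),
    descSorted a i

/-- `tailSum a K = ∑_{i ≥ K} a^↓_i` (1-based indices `i`, comparison `K ≤ (i : ℝ)`,
equivalently `i ≥ ⌈K⌉`). -/
def tailSum {α : Type*} [Fintype α] (a : α → ℝ) (K : ℝ) : ℝ :=
  ∑ i ∈ Finset.univ.filter (fun i : Fin (Fintype.card α) => K ≤ ((i : ℕ) + 1 : ℝ)),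
    descSorted a i

/-- `a` majorises `b` (written `a ≻ b`): every partial sum of the non-increasingly sorted
`a` dominates the corresponding partial sum of sorted `b` (shorter vectors padded with zeros). -/
def Maj {α β : Type*} [Fintype α] [Fintype β] (a : α → ℝ) (b : β → ℝ) : Prop :=
  ∀ j : ℕ, headSum b (j : ℝ) ≤ headSum a (j : ℝ)

/-- `a ≻_ε b`: approximate majorisation (from above) with total variation error:
there is a probability distribution `b̃` with `a ≻ b̃` and `δ(b, b̃) ≤ ε`. -/
def ApproxMajTV {α β : Type*} [Fintype α] [Fintype β] (a : α → ℝ) (b : β → ℝ) (ε : ℝ) : Prop :=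
  ∃ bt : β → ℝ, IsProbDist bt ∧ Maj a bt ∧ tvd b bt ≤ ε

/-- `a ≺_ε b`: approximate majorisation (from below) with total variation error:
there is a probability distribution `b̃` with `a ≺ b̃` and `δ(b, b̃) ≤ ε`. -/
def ApproxSubMajTV {α β : Type*} [Fintype α] [Fintype β] (a : α → ℝ) (b : β → ℝ) (ε : ℝ) : Prop :=
  ∃ bt : β → ℝ, IsProbDist bt ∧ Maj bt a ∧ tvd b bt ≤ ε

/-- A moderate sequence: `t n → 0` and `√n · t n → +∞`. -/
def ModerateSeq (t : ℕ → ℝ) : Prop :=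
  Tendsto t atTop (𝓝 0) ∧ Tendsto (fun n : ℕ => Real.sqrt (n : ℝ) * t n) atTop atTop

/-- The uniform distribution on `Fin d`. -/
def unif (d : ℕ) : Fin d → ℝ := fun _ => 1 / (d : ℝ)

/-- The embedding map `Γ` associated with `γ_i = c_i / N`: for each `i` it produces
`c_i` entries equal to `a_i / c_i`. -/
def embed {d : ℕ} (c : Fin d → ℕ) (a : Fin d → ℝ) : (Σ i : Fin d, Fin (c i)) → ℝ :=
  fun x => a x.1 / (c x.1 : ℝ)

/-- Cut-and-pile modification of the sorted version of `a`, with cut at `K`: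
the first entry absorbs the total mass of entries at (1-based) positions `≥ K`,
entries at positions `1 < i < K` are unchanged, and entries at positions `≥ K` are set to 0. -/
def cutAndPile {α : Type*} [Fintype α] (a : α → ℝ) (K : ℝ) : Fin (Fintype.card α) → ℝ :=
  fun i =>
    if (i : ℕ) = 0 then descSorted a i + tailSum a K
    else if ((i : ℕ) + 1 : ℝ) < K then descSorted a i else 0

/-- The mass that the `k`-fold product of `a` puts on `{f | ℓ ≤ ∑ j, X (f j)}`. -/
def upperTail {α : Type*} [Fintype α] (a X : α → ℝ) (k : ℕ) (ℓ : ℝ) : ℝ :=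
  ∑ f : Fin k → α, if ℓ ≤ ∑ j, X (f j) then tpow a k f else 0

/-- The moment generating function of `X` under the weights `a`. -/
def finMgf {α : Type*} [Fintype α] (a X : α → ℝ) (θ : ℝ) : ℝ :=
  ∑ i, a i * exp (θ * X i)

lemma tpow_nonneg {α : Type*} {a : α → ℝ} (ha : ∀ i, 0 ≤ a i) (k : ℕ) (f : Fin k → α) : 0 ≤ tpow a k f :=
  Finset.prod_nonneg fun _ _ => ha _

section Deviations

variable {α : Type*} [Fintype α] {a X : α → ℝ}

lemma sum_tpow_mul_exp (a X : α → ℝ) (k : ℕ) (θ : ℝ) :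
    ∑ f : Fin k → α, tpow a k f * exp (θ * ∑ j, X (f j)) = finMgf a X θ ^ k := by
  rw [finMgf, Finset.sum_pow']
  refine Fintype.sum_congr _ _ fun f => ?_
  simp only [tpow, Finset.mul_sum, Real.exp_sum, Finset.prod_mul_distrib]

lemma sum_tpow (a : α → ℝ) (k : ℕ) : ∑ f : Fin k → α, tpow a k f = (∑ i, a i) ^ k := by
  simpa [finMgf] using sum_tpow_mul_exp a (fun _ => 0) k 0

lemma upperTail_antitone (ha : ∀ i, 0 ≤ a i) (k : ℕ) : Antitone (upperTail a X k) := by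
  intro ℓ ℓ' h
  refine Finset.sum_le_sum fun f _ => ?_
  have := tpow_nonneg ha k f
  split_ifs <;> linarith

lemma upperTail_sub_const (a X : α → ℝ) (μ z : ℝ) (k : ℕ) :
    upperTail a (fun i => X i - μ) k (k * z) = upperTail a X k (k * (μ + z)) := by
  refine Finset.sum_congr rfl fun f _ => if_congr ?_ rfl rfl
  simp only [Finset.sum_sub_distrib, Finset.sum_const, Finset.card_univ, Fintype.card_fin,
    nsmul_eq_mul]
  constructor <;> intro h <;> linarith

/-- Chernoff's bound. -/
lemma upperTail_le (ha : ∀ i, 0 ≤ a i) (k : ℕ) (ℓ : ℝ) {θ : ℝ} (hθ : 0 ≤ θ) :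
    upperTail a X k ℓ ≤ exp (-(θ * ℓ)) * finMgf a X θ ^ k := by
  rw [← sum_tpow_mul_exp, Finset.mul_sum]
  refine Finset.sum_le_sum fun f _ => ?_
  have h0 := tpow_nonneg ha k f
  split_ifs with h
  · have h1 : 1 ≤ exp (θ * ∑ j, X (f j) - θ * ℓ) :=
      Real.one_le_exp (by nlinarith [mul_le_mul_of_nonneg_left h hθ])
    calc tpow a k f ≤ tpow a k f * exp (θ * ∑ j, X (f j) - θ * ℓ) := le_mul_of_one_le_right h0 h1
      _ = _ := by rw [sub_eq_add_neg, Real.exp_add]; ring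
  · positivity

/-- A lower bound on the upper tail by exponential tilting: the tilted mass outside of `[ℓ, b]` is
controlled by Chernoff's bound. -/
lemma le_upperTail_mul_exp (ha : ∀ i, 0 ≤ a i) (k : ℕ) (ℓ b : ℝ) {θ θ' : ℝ} (hθ : 0 ≤ θ)
    (hθ' : 0 ≤ θ') :
    finMgf a X θ ^ k - exp (θ' * ℓ) * finMgf a X (θ - θ') ^ k
      - exp (-(θ' * b)) * finMgf a X (θ + θ') ^ k ≤ upperTail a X k ℓ * exp (θ * b) := by
  simp only [← sum_tpow_mul_exp, upperTail, Finset.sum_mul]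
  rw [Finset.mul_sum, Finset.mul_sum, ← Finset.sum_sub_distrib, ← Finset.sum_sub_distrib]
  refine Finset.sum_le_sum fun f _ => ?_
  set S := ∑ j, X (f j)
  have h0 := tpow_nonneg ha k f
  have e1 : exp (θ' * ℓ) * (tpow a k f * exp ((θ - θ') * S))
      = tpow a k f * exp (θ * S) * exp (θ' * (ℓ - S)) := by
    rw [show (θ - θ') * S = θ * S + -(θ' * S) by ring, show θ' * (ℓ - S) = θ' * ℓ + -(θ' * S) by ring,
      Real.exp_add, Real.exp_add]; ring
  have e2 : exp (-(θ' * b)) * (tpow a k f * exp ((θ + θ') * S))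
      = tpow a k f * exp (θ * S) * exp (θ' * (S - b)) := by
    rw [show (θ + θ') * S = θ * S + θ' * S by ring, show θ' * (S - b) = θ' * S + -(θ' * b) by ring,
      Real.exp_add, Real.exp_add]; ring
  rw [e1, e2]
  have hw : 0 ≤ tpow a k f * exp (θ * S) := by positivity
  have p1 := mul_nonneg hw (Real.exp_pos (θ' * (ℓ - S))).le
  have p2 := mul_nonneg hw (Real.exp_pos (θ' * (S - b))).le
  split_ifs with h
  · rcases le_total S b with hb | hb
    · have : exp (θ * S) ≤ exp (θ * b) := Real.exp_le_exp.2 (mul_le_mul_of_nonneg_left hb hθ)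
      nlinarith [mul_le_mul_of_nonneg_left this h0]
    · have : 1 ≤ exp (θ' * (S - b)) := Real.one_le_exp (mul_nonneg hθ' (sub_nonneg.2 hb))
      have := mul_le_mul_of_nonneg_left this hw
      have : 0 ≤ tpow a k f * exp (θ * b) := by positivity
      linarith
  · have : 1 ≤ exp (θ' * (ℓ - S)) := Real.one_le_exp (mul_nonneg hθ' (by linarith))
    have := mul_le_mul_of_nonneg_left this hw
    linarith

lemma abs_exp_sub_quadratic_le {y : ℝ} (hy : |y| ≤ 1) : |exp y - (1 + y + y ^ 2 / 2)| ≤ |y| ^ 3 := by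
  have h := Real.exp_bound hy (n := 3) (by norm_num)
  have e : ∑ m ∈ Finset.range 3, y ^ m / (m.factorial : ℝ) = 1 + y + y ^ 2 / 2 := by
    simp [Finset.sum_range_succ, Nat.factorial]
  rw [e] at h
  refine h.trans ?_
  exact mul_le_of_le_one_right (by positivity) (by norm_num [Nat.factorial])

/-- Second order expansion at `0` of the moment generating function of a centred variable. -/
lemma finMgf_bounds (ha : IsProbDist a) (hmean : ∑ i, a i * X i = 0) {V η : ℝ}
    (hV : ∑ i, a i * X i ^ 2 = V) (hη : 0 < η) :
    ∃ θ₀ > 0, ∀ θ : ℝ, |θ| ≤ θ₀ →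
      exp (θ ^ 2 * (V / 2 - η)) ≤ finMgf a X θ ∧ finMgf a X θ ≤ exp (θ ^ 2 * (V / 2 + η)) := by
  have hV0 : 0 ≤ V := hV ▸ Finset.sum_nonneg fun i _ => mul_nonneg (ha.1 i) (sq_nonneg _)
  obtain ⟨C, hC1, hC⟩ : ∃ C : ℝ, 1 ≤ C ∧ ∀ i, |X i| ≤ C := by
    refine ⟨1 + ∑ i, |X i|, le_add_of_nonneg_right (by positivity), fun i => ?_⟩
    have := Finset.single_le_sum (f := fun i => |X i|) (fun i _ => abs_nonneg _) (Finset.mem_univ i)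
    linarith
  have hcube : ∀ θ : ℝ, |θ| * C ≤ 1 → |finMgf a X θ - (1 + θ ^ 2 * (V / 2))| ≤ |θ| ^ 3 * C ^ 3 := by
    intro θ hθ
    have e : finMgf a X θ - (1 + θ ^ 2 * (V / 2))
        = ∑ i, a i * (exp (θ * X i) - (1 + θ * X i + (θ * X i) ^ 2 / 2)) := by
      have e' : ∑ i, a i * (1 + θ * X i + (θ * X i) ^ 2 / 2)
          = ∑ i, a i + θ * ∑ i, a i * X i + θ ^ 2 / 2 * ∑ i, a i * X i ^ 2 := by
        simp only [Finset.mul_sum, ← Finset.sum_add_distrib]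
        exact Finset.sum_congr rfl fun i _ => by ring
      simp only [mul_sub, Finset.sum_sub_distrib, e', ha.2, hmean, hV, finMgf]
      ring
    rw [e]
    calc _ ≤ ∑ i, a i * (|θ| ^ 3 * C ^ 3) := by
          refine (Finset.abs_sum_le_sum_abs _ _).trans (Finset.sum_le_sum fun i _ => ?_)
          rw [abs_mul, abs_of_nonneg (ha.1 i)]
          have h1 : |θ * X i| ≤ |θ| * C := by
            rw [abs_mul]; exact mul_le_mul_of_nonneg_left (hC i) (abs_nonneg _)
          refine mul_le_mul_of_nonneg_left ?_ (ha.1 i)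
          refine (abs_exp_sub_quadratic_le (h1.trans hθ)).trans ?_
          rw [← mul_pow]
          exact pow_le_pow_left₀ (abs_nonneg _) h1 3
      _ = _ := by rw [← Finset.sum_mul, ha.2, one_mul]
  have hC0 : 0 < C := by linarith
  set m := min (1 / C) (min (η / (2 * C ^ 3)) (η / (2 * (V ^ 2 + 1)))) with hm
  have hm0 : 0 < m := by positivity
  refine ⟨min m (1 / (V + 1)), by positivity, fun θ hθ => ?_⟩
  have hθ1 : |θ| * (V + 1) ≤ 1 := by
    rw [← le_div_iff₀ (by positivity)]; exact hθ.trans (min_le_right _ _)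
  have hθm : |θ| ≤ m := hθ.trans (min_le_left _ _)
  have h1 : |θ| * C ≤ 1 := by
    rw [← le_div_iff₀ hC0]; exact hθm.trans (min_le_left _ _)
  have h2 : |θ| * C ^ 3 ≤ η / 2 := by
    rw [← le_div_iff₀ (by positivity), div_div]
    exact hθm.trans ((min_le_right _ _).trans (min_le_left _ _))
  have h3 : |θ| * (V ^ 2 + 1) ≤ η / 2 := by
    rw [← le_div_iff₀ (by positivity), div_div]
    exact hθm.trans ((min_le_right _ _).trans (min_le_right _ _))
  have hb := abs_le.1 (hcube θ h1)
  have habs := abs_nonneg θ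
  have hsq : |θ| ^ 2 = θ ^ 2 := sq_abs θ
  have h4 : |θ| ^ 3 * C ^ 3 ≤ θ ^ 2 * (η / 2) := by
    rw [← hsq]; nlinarith [mul_le_mul_of_nonneg_left h2 (sq_nonneg |θ|)]
  constructor
  · rcases le_total (V / 2) η with hVη | hVη
    · calc exp (θ ^ 2 * (V / 2 - η)) ≤ 1 :=
            Real.exp_le_one_iff.2 (mul_nonpos_of_nonneg_of_nonpos (sq_nonneg θ) (by linarith))
        _ = ∑ i, a i * (θ * X i + 1) := by
            simp only [mul_add, Finset.sum_add_distrib, mul_one, ha.2, mul_left_comm _ θ,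
              ← Finset.mul_sum, hmean, mul_zero, zero_add]
        _ ≤ _ := Finset.sum_le_sum fun i _ =>
            mul_le_mul_of_nonneg_left (Real.add_one_le_exp _) (ha.1 i)
    · have hle : |θ| ≤ 1 := by nlinarith
      set y := θ ^ 2 * (V / 2 - η) with hy
      have hy0 : 0 ≤ y := mul_nonneg (sq_nonneg θ) (by linarith)
      have hy1 : y ≤ 1 / 2 := by
        have : |θ| ^ 2 * (V + 1) ≤ 1 := by nlinarith
        rw [hy, ← hsq]; nlinarith [sq_nonneg |θ|]
      have hx : 1 + (y + θ ^ 2 * (η / 2)) ≤ finMgf a X θ := by rw [hy]; linarith [hb.1]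
      refine le_trans ?_ hx
      have hexp : exp y * (1 - y) ≤ 1 := by
        calc exp y * (1 - y) ≤ exp y * exp (-y) :=
              mul_le_mul_of_nonneg_left (by linarith [Real.add_one_le_exp (-y)]) (Real.exp_pos _).le
          _ = 1 := by rw [← Real.exp_add]; simp
      have hxy : (y + θ ^ 2 * (η / 2)) * y ≤ θ ^ 2 * (η / 2) := by
        have h5 : y + θ ^ 2 * (η / 2) ≤ θ ^ 2 * V := by rw [hy]; nlinarith [sq_nonneg θ]
        have h6 : y ≤ θ ^ 2 * V := by rw [hy]; nlinarith [sq_nonneg θ]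
        have h7 : θ ^ 2 * V ^ 2 ≤ η / 2 := by rw [← hsq]; nlinarith [sq_nonneg V]
        have : (y + θ ^ 2 * (η / 2)) * y ≤ (θ ^ 2 * V) * (θ ^ 2 * V) :=
          mul_le_mul h5 h6 hy0 (by positivity)
        nlinarith [mul_le_mul_of_nonneg_left h7 (sq_nonneg θ)]
      have : exp y * (1 - y) ≤ (1 + (y + θ ^ 2 * (η / 2))) * (1 - y) := by nlinarith
      exact le_of_mul_le_mul_right this (by linarith)
  · have := Real.add_one_le_exp (θ ^ 2 * (V / 2 + η))
    nlinarith [hb.2, mul_nonneg (sq_nonneg θ) hη.le]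

lemma centred_moments (ha : IsProbDist a) :
    ∑ i, a i * (X i - ∑ j, a j * X j) = 0 := by
  simp only [mul_sub, Finset.sum_sub_distrib, ← Finset.sum_mul, ha.2, one_mul, sub_self]

/-- Moderate deviation upper bound. -/
lemma upperTail_le_exp (ha : IsProbDist a) {μ V c : ℝ} (hμ : ∑ i, a i * X i = μ)
    (hV : ∑ i, a i * (X i - μ) ^ 2 = V) (hV0 : 0 < V) (hc : 2 * V < c) :
    ∃ z₀ > 0, ∀ (k : ℕ) (z : ℝ), 0 ≤ z → z ≤ z₀ →
      upperTail a X k (k * (μ + z)) ≤ exp (-(k * z ^ 2 / c)) := by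
  have hc0 : 0 < c := by linarith
  set η := V ^ 2 * (1 / (2 * V) - 1 / c) with hη
  have hη0 : 0 < η := by
    have : 1 / c < 1 / (2 * V) := one_div_lt_one_div_of_lt (by linarith) hc
    exact mul_pos (by positivity) (by linarith)
  obtain ⟨θ₀, hθ₀, h⟩ := finMgf_bounds ha (X := fun i => X i - μ) (hμ ▸ centred_moments ha) hV hη0
  refine ⟨θ₀ * V, by positivity, fun k z hz hz0 => ?_⟩
  have hθ : 0 ≤ z / V := by positivity
  have hM := (h (z / V) (by rw [abs_of_nonneg hθ, div_le_iff₀ hV0]; exact hz0)).2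
  have hM0 : 0 ≤ finMgf a (fun i => X i - μ) (z / V) :=
    Finset.sum_nonneg fun i _ => mul_nonneg (ha.1 i) (Real.exp_pos _).le
  rw [← upperTail_sub_const]
  refine (upperTail_le ha.1 k _ hθ).trans ?_
  refine (mul_le_mul_of_nonneg_left (pow_le_pow_left₀ hM0 hM k) (Real.exp_pos _).le).trans ?_
  rw [← Real.exp_nat_mul, ← Real.exp_add]
  refine (congrArg exp ?_).le
  rw [hη]
  field_simp
  ring

/-- Moderate deviation lower bound. -/
lemma exp_le_upperTail (ha : IsProbDist a) {μ V c : ℝ} (hμ : ∑ i, a i * X i = μ)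
    (hV : ∑ i, a i * (X i - μ) ^ 2 = V) (hc0 : 0 < c) (hc : c < 2 * V) :
    ∃ z₀ > 0, ∃ K : ℝ, ∀ (k : ℕ) (z : ℝ), 0 ≤ z → z ≤ z₀ → K ≤ k * z ^ 2 →
      exp (-(k * z ^ 2 / c)) ≤ upperTail a X k (k * (μ + z)) := by
  have hV0 : 0 < V := by linarith
  obtain ⟨δ, hδ0, hδ⟩ : ∃ δ > 0, (1 + δ) * (1 + 3 * δ) / (2 * V) + 2 * δ ^ 2 / V < 1 / c := by
    have hcont : Continuous fun δ : ℝ => (1 + δ) * (1 + 3 * δ) / (2 * V) + 2 * δ ^ 2 / V := by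
      fun_prop
    have h0 : (1 + (0 : ℝ)) * (1 + 3 * 0) / (2 * V) + 2 * 0 ^ 2 / V < 1 / c := by
      have := one_div_lt_one_div_of_lt hc0 hc
      simpa using this
    have hev := (hcont.tendsto 0).eventually_lt_const h0
    have := (hev.filter_mono nhdsWithin_le_nhds : ∀ᶠ δ in 𝓝[>] (0 : ℝ), _)
    obtain ⟨δ, h1, h2⟩ := (this.and self_mem_nhdsWithin).exists
    exact ⟨δ, h2, h1⟩
  set η := V * δ ^ 2 / (8 * (1 + 2 * δ) ^ 2) with hη
  have hη0 : 0 < η := by positivity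
  obtain ⟨θ₀, hθ₀, h⟩ := finMgf_bounds ha (X := fun i => X i - μ) (hμ ▸ centred_moments ha) hV hη0
  refine ⟨θ₀ * V / (1 + 2 * δ), by positivity, 4 * V * Real.log 4 / δ ^ 2, fun k z hz hz0 hK => ?_⟩
  rw [le_div_iff₀ (by positivity)] at hz0
  set θ := (1 + δ) * z / V with hθ
  set θ' := δ * z / V with hθ'
  have hle : ∀ x, 0 ≤ x → x ≤ 1 + 2 * δ → |x * z / V| ≤ θ₀ := by
    intro x hx hx'
    rw [abs_of_nonneg (by positivity), div_le_iff₀ hV0]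
    nlinarith
  have hEta : ∀ x, 0 ≤ x → x ≤ 1 + 2 * δ → (x * z / V) ^ 2 * η ≤ z ^ 2 / V * (δ ^ 2 / 8) := by
    intro x hx hx'
    have : x ^ 2 / (1 + 2 * δ) ^ 2 ≤ 1 :=
      (div_le_one (by positivity)).2 (pow_le_pow_left₀ hx hx' 2)
    calc _ = z ^ 2 / V * (δ ^ 2 / 8) * (x ^ 2 / (1 + 2 * δ) ^ 2) := by
          rw [hη]; field_simp
      _ ≤ _ := mul_le_of_le_one_right (by positivity) this
  set M := finMgf a (fun i => X i - μ)
  have hMnn : ∀ x, 0 ≤ M x := fun x =>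
    Finset.sum_nonneg fun i _ => mul_nonneg (ha.1 i) (Real.exp_pos _).le
  have key := le_upperTail_mul_exp (X := fun i => X i - μ) ha.1 k (k * z) (k * ((1 + 2 * δ) * z))
    (θ := θ) (θ' := θ') (by positivity) (by positivity)
  rw [upperTail_sub_const] at key
  change M θ ^ k - _ * M (θ - θ') ^ k - _ * M (θ + θ') ^ k ≤ _ at key
  have e1 : θ - θ' = 1 * z / V := by rw [hθ, hθ']; ring
  have e2 : θ + θ' = (1 + 2 * δ) * z / V := by rw [hθ, hθ']; ring
  set w := k * z ^ 2 / V with hw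
  have hkz : 0 ≤ (k : ℝ) := Nat.cast_nonneg k
  have hT0 : exp (w * ((1 + δ) ^ 2 / 2 - δ ^ 2 / 8)) ≤ M θ ^ k := by
    refine le_trans ?_ (pow_le_pow_left₀ (Real.exp_pos _).le
      (h θ (hle _ (by positivity) (by linarith))).1 k)
    rw [← Real.exp_nat_mul, Real.exp_le_exp]
    have := mul_le_mul_of_nonneg_left (hEta (1 + δ) (by positivity) (by linarith)) hkz
    have e : w * ((1 + δ) ^ 2 / 2 - δ ^ 2 / 8)
        = k * (θ ^ 2 * (V / 2)) - k * (z ^ 2 / V * (δ ^ 2 / 8)) := by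
      rw [hw, hθ]; field_simp
    rw [e, mul_sub (θ ^ 2), mul_sub (k : ℝ)]
    linarith
  have hT : ∀ x A B, 0 ≤ x → x ≤ 1 + 2 * δ → A = w * B → B + x ^ 2 / 2 = 1 / 2 + δ →
      exp A * M (x * z / V) ^ k ≤ exp (w * (1 / 2 + δ + δ ^ 2 / 8)) := by
    intro x A B hx hx' hA hB
    refine (mul_le_mul_of_nonneg_left (pow_le_pow_left₀ (hMnn _) (h _ (hle x hx hx')).2 k)
      (Real.exp_pos _).le).trans ?_
    rw [← Real.exp_nat_mul, ← Real.exp_add, Real.exp_le_exp]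
    have := mul_le_mul_of_nonneg_left (hEta x hx hx') hkz
    have e : w * (1 / 2 + δ + δ ^ 2 / 8)
        = A + k * ((x * z / V) ^ 2 * (V / 2)) + k * (z ^ 2 / V * (δ ^ 2 / 8)) := by
      rw [← hB, hA, hw]; field_simp
    rw [e, mul_add ((x * z / V) ^ 2), mul_add (k : ℝ)]
    linarith
  have hT1 := hT 1 (θ' * (k * z)) δ zero_le_one (by linarith)
    (by rw [hθ', hw]; ring) (by ring)
  have hT2 := hT (1 + 2 * δ) (-(θ' * (k * ((1 + 2 * δ) * z)))) (-(δ * (1 + 2 * δ))) (by positivity)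
    le_rfl (by rw [hθ', hw]; field_simp) (by ring)
  rw [e1, e2] at key
  have hlog : Real.log 4 ≤ w * (δ ^ 2 / 4) := by
    rw [hw, div_mul_eq_mul_div, le_div_iff₀ hV0]
    rw [div_le_iff₀ (by positivity)] at hK
    linarith
  have hsmall : exp (w * (1 / 2 + δ + δ ^ 2 / 8)) * 4 ≤ exp (w * ((1 + δ) ^ 2 / 2 - δ ^ 2 / 8)) := by
    have e : exp (w * (1 / 2 + δ + δ ^ 2 / 8)) * 4
        = exp (w * (1 / 2 + δ + δ ^ 2 / 8) + Real.log 4) := by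
      rw [Real.exp_add, Real.exp_log (by norm_num)]
    rw [e, Real.exp_le_exp]
    linarith
  have hhalf : exp (w * (1 / 2 + δ + δ ^ 2 / 8)) ≤
      upperTail a X k (k * (μ + z)) * exp (θ * (k * ((1 + 2 * δ) * z))) := by
    linarith [Real.exp_pos (w * (1 / 2 + δ + δ ^ 2 / 8))]
  have hw0 : 0 ≤ w := by positivity
  calc exp (-(k * z ^ 2 / c))
      ≤ exp (w * (1 / 2 + δ + δ ^ 2 / 8)) * exp (-(θ * (k * ((1 + 2 * δ) * z)))) := by
        rw [← Real.exp_add, Real.exp_le_exp]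
        have e : θ * (k * ((1 + 2 * δ) * z)) = w * ((1 + δ) * (1 + 2 * δ)) := by
          rw [hθ, hw]; field_simp
        have e' : k * z ^ 2 / c = w * (V * (1 / c)) := by rw [hw]; field_simp
        rw [e, e']
        have : (1 + δ) * (1 + 3 * δ) / 2 + 2 * δ ^ 2 ≤ V * (1 / c) := by
          have := mul_le_mul_of_nonneg_left hδ.le hV0.le
          refine le_trans (le_of_eq ?_) this
          field_simp
        nlinarith [mul_le_mul_of_nonneg_left this hw0, mul_nonneg hw0 (sq_nonneg δ)]
    _ ≤ _ := by
        rw [Real.exp_neg, ← div_eq_mul_inv, div_le_iff₀ (Real.exp_pos _)]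
        exact hhalf

end Deviations

section Majorisation

variable {α β : Type*} [Fintype α] [Fintype β]

/-- `headSum a k` is the sum of `a` over a set of `k` largest entries. -/
lemma exists_headSum_eq {a : α → ℝ} (ha : ∀ i, 0 ≤ a i) (k : ℕ) :
    ∃ (s : Finset α) (θ : ℝ), 0 ≤ θ ∧ s.card = min k (Fintype.card α) ∧
      headSum a k = ∑ i ∈ s, a i ∧ (∀ i ∈ s, θ ≤ a i) ∧ ∀ i ∉ s, a i ≤ θ := by
  set e : Fin (Fintype.card α) ≃ α :=
    (Tuple.sort fun j => -a ((Fintype.equivFin α).symm j)).trans (Fintype.equivFin α).symm with he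
  have hdesc : descSorted a = a ∘ e := rfl
  have hanti : Antitone (a ∘ e) := fun i j hij =>
    neg_le_neg_iff.1 (Tuple.monotone_sort (fun j => -a ((Fintype.equivFin α).symm j)) hij)
  set u := Finset.univ.filter fun i : Fin (Fintype.card α) => ((i : ℕ) + 1 : ℝ) ≤ k with hu
  have hmem : ∀ i, i ∈ u ↔ (i : ℕ) < k := by
    intro i
    simp only [hu, Finset.mem_filter, Finset.mem_univ, true_and]
    exact_mod_cast Iff.rfl
  have hcard : u.card = min k (Fintype.card α) := by
    rw [show u = Finset.univ.filter fun i : Fin (Fintype.card α) => (i : ℕ) < k by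
      ext i; simp [hmem], Fin.card_filter_val_lt, min_comm]
  have hsum : headSum a k = ∑ i ∈ u.map e.toEmbedding, a i := by
    rw [Finset.sum_map]; rfl
  rcases lt_or_ge k (Fintype.card α) with hk | hk
  · refine ⟨u.map e.toEmbedding, a (e ⟨k, hk⟩), ha _, by rw [Finset.card_map, hcard], hsum, ?_, ?_⟩
    · simp only [Finset.mem_map]
      rintro _ ⟨i, hi, rfl⟩
      exact hanti (Fin.le_def.2 ((hmem i).1 hi).le)
    · intro x hx
      obtain ⟨i, rfl⟩ := e.surjective x
      have hi : i ∉ u := fun h => hx (Finset.mem_map_of_mem _ h)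
      rw [hmem, not_lt] at hi
      exact hanti (Fin.le_def.2 hi)
  · refine ⟨u.map e.toEmbedding, 0, le_rfl, by rw [Finset.card_map, hcard], hsum,
      fun i _ => ha i, fun x hx => ?_⟩
    obtain ⟨i, rfl⟩ := e.surjective x
    exact absurd (Finset.mem_map_of_mem _ ((hmem i).2 (i.2.trans_le hk))) hx

lemma sum_le_headSum {a : α → ℝ} (ha : ∀ i, 0 ≤ a i) {s : Finset α} {k : ℕ} (hs : s.card ≤ k) :
    ∑ i ∈ s, a i ≤ headSum a k := by
  classical
  obtain ⟨u, θ, hθ, hcard, hsum, hin, hout⟩ := exists_headSum_eq ha k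
  have hsu : (s.card : ℝ) ≤ u.card := by
    exact_mod_cast hcard ▸ le_min hs (Finset.card_le_univ s)
  rw [hsum]
  have h1 : ∑ i ∈ s, (a i - θ) ≤ ∑ i ∈ u, (a i - θ) := by
    calc ∑ i ∈ s, (a i - θ) ≤ ∑ i ∈ s ∩ u, (a i - θ) := by
          rw [← Finset.sum_inter_add_sum_sdiff s u]
          have : ∑ i ∈ s \ u, (a i - θ) ≤ 0 := Finset.sum_nonpos fun i hi =>
            sub_nonpos.2 (hout i (Finset.mem_sdiff.1 hi).2)
          linarith
      _ ≤ _ := Finset.sum_le_sum_of_subset_of_nonneg Finset.inter_subset_right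
          fun i hi _ => sub_nonneg.2 (hin i hi)
  simp only [Finset.sum_sub_distrib, Finset.sum_const, nsmul_eq_mul] at h1
  linarith [mul_le_mul_of_nonneg_right hsu hθ]

lemma headSum_le_filter_add {a : α → ℝ} (ha : ∀ i, 0 ≤ a i) (k : ℕ) {σ : ℝ} (hσ : 0 ≤ σ) :
    headSum a k ≤ (∑ i, if σ ≤ a i then a i else 0) + k * σ := by
  obtain ⟨u, -, -, hcard, hsum, -⟩ := exists_headSum_eq ha k
  rw [hsum]
  calc ∑ i ∈ u, a i ≤ ∑ i ∈ u, ((if σ ≤ a i then a i else 0) + σ) := by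
        refine Finset.sum_le_sum fun i _ => ?_
        split_ifs <;> linarith
    _ = ∑ i ∈ u, (if σ ≤ a i then a i else 0) + u.card * σ := by
        simp [Finset.sum_add_distrib]
    _ ≤ _ := by
        refine add_le_add (Finset.sum_le_univ_sum_of_nonneg fun i => ?_)
          (mul_le_mul_of_nonneg_right ?_ hσ)
        · split_ifs
          exacts [ha i, le_rfl]
        · exact_mod_cast hcard ▸ min_le_left _ _

/-- `1 - tvd` is the overlap of two distributions. -/
lemma one_sub_tvd {a b : α → ℝ} (ha : ∑ i, a i = 1) (hb : ∑ i, b i = 1) :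
    1 - tvd a b = ∑ i, min (a i) (b i) := by
  have h : ∀ i, |a i - b i| = a i + b i - 2 * min (a i) (b i) := by
    intro i
    rcases le_total (a i) (b i) with h | h
    · rw [min_eq_left h, abs_of_nonpos (by linarith)]; ring
    · rw [min_eq_right h, abs_of_nonneg (by linarith)]; ring
  simp only [tvd, h, Finset.sum_sub_distrib, Finset.sum_add_distrib, ha, hb, ← Finset.mul_sum]
  ring

lemma IsProbDist.card_mul_le {a : α → ℝ} (ha : IsProbDist a) {s : Finset α} {τ : ℝ}
    (h : ∀ i ∈ s, τ ≤ a i) : s.card * τ ≤ 1 := by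
  calc (s.card : ℝ) * τ = ∑ i ∈ s, τ := by simp
    _ ≤ ∑ i ∈ s, a i := Finset.sum_le_sum h
    _ ≤ ∑ i, a i := Finset.sum_le_univ_sum_of_nonneg ha.1
    _ = 1 := ha.2

/-- Necessary condition for approximate majorisation. -/
lemma ApproxMajTV.one_sub_le {u : α → ℝ} {w : β → ℝ} {ε : ℝ} (h : ApproxMajTV u w ε)
    (hu : IsProbDist u) (hw : IsProbDist w) {σ τ : ℝ} (hσ : 0 ≤ σ) (hτ : 0 < τ) :
    1 - ε ≤ (∑ i, if σ ≤ u i then u i else 0) + (∑ i, if w i ≤ τ then w i else 0) + σ / τ := by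
  obtain ⟨b, hb, hmaj, htv⟩ := h
  set s := Finset.univ.filter fun i => τ < w i with hs
  have hcard : (s.card : ℝ) ≤ 1 / τ := by
    rw [le_div_iff₀ hτ]
    exact hw.card_mul_le fun i hi => (Finset.mem_filter.1 hi).2.le
  have h1 : 1 - ε ≤ ∑ i, min (w i) (b i) := by rw [← one_sub_tvd hw.2 hb.2]; linarith
  have h2 : ∑ i, min (w i) (b i) ≤ (∑ i, if w i ≤ τ then w i else 0) + ∑ i ∈ s, b i := by
    rw [hs, Finset.sum_filter, ← Finset.sum_add_distrib]
    refine Finset.sum_le_sum fun i _ => ?_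
    rcases le_or_gt (w i) τ with h | h
    · simp [h, not_lt.2 h]
    · simp [h, not_le.2 h]
  have h3 := (sum_le_headSum hb.1 le_rfl).trans ((hmaj _).trans (headSum_le_filter_add hu.1 s.card hσ))
  have h4 : s.card * σ ≤ σ / τ := by
    rw [div_eq_mul_one_div, mul_comm]; exact mul_le_mul_of_nonneg_left hcard hσ
  linarith

/-- Sufficient condition for approximate majorisation. -/
lemma approxMajTV_of_le {u : α → ℝ} {w : β → ℝ} (hu : IsProbDist u) (hw : IsProbDist w) {M : ℕ}
    (hα : Fintype.card α = M) (hβ : Fintype.card β = M) (hM : 0 < M) {l σ τ : ℝ} (hl : 0 < l)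
    (hl1 : l ≤ 1) (hτ : 0 ≤ τ) (hτσ : τ + 1 / M ≤ σ)
    (hwl : l ≤ ∑ i, if w i ≤ τ then w i else 0)
    (hul : l + 1 / (σ * M) ≤ ∑ i, if σ ≤ u i then u i else 0) :
    ApproxMajTV u w (1 - l) := by
  classical
  have hM' : (0 : ℝ) < M := by exact_mod_cast hM
  have hσ : 0 < σ := lt_of_lt_of_le (by positivity) hτσ
  set B := ∑ i, if w i ≤ τ then w i else 0 with hB
  have hB0 : 0 < B := hl.trans_le hwl
  have hlB : l / B ≤ 1 := (div_le_one hB0).2 hwl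
  set v : β → ℝ := fun i => l / B * if w i ≤ τ then w i else 0 with hv
  have hv0 : ∀ i, 0 ≤ v i := fun i =>
    mul_nonneg (by positivity) (by split_ifs; exacts [hw.1 i, le_rfl])
  have hvτ : ∀ i, v i ≤ τ := by
    intro i
    simp only [hv]
    split_ifs with h
    · exact (mul_le_of_le_one_left (hw.1 i) hlB).trans h
    · simpa using hτ
  have hvw : ∀ i, v i ≤ w i := by
    intro i
    simp only [hv]
    split_ifs with h
    · exact mul_le_of_le_one_left (hw.1 i) hlB
    · simpa using hw.1 i
  have hvsum : ∑ i, v i = l := by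
    rw [hv, ← Finset.mul_sum, ← hB]; field_simp
  have hr0 : 0 ≤ (1 - l) / M := div_nonneg (by linarith) hM'.le
  have hr1 : (1 - l) / M ≤ 1 / M := div_le_div_of_nonneg_right (by linarith) hM'.le
  have hb : IsProbDist fun i => v i + (1 - l) / M := by
    refine ⟨fun i => add_nonneg (hv0 i) hr0, ?_⟩
    rw [Finset.sum_add_distrib, hvsum, Finset.sum_const, Finset.card_univ, hβ, nsmul_eq_mul]
    field_simp
    ring
  refine ⟨_, hb, fun k => ?_, ?_⟩
  · obtain ⟨s, -, -, hs, hsum, -⟩ := exists_headSum_eq hb.1 k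
    obtain ⟨s', θ, -, hs', hsum', hin, hout⟩ := exists_headSum_eq hu.1 k
    rw [hsum]
    set r := min k M with hr
    rw [hβ, ← hr] at hs
    rw [hα, ← hr] at hs'
    set T := Finset.univ.filter fun i => σ ≤ u i with hT
    have hTsum : l + 1 / (σ * M) ≤ ∑ i ∈ T, u i := by rw [hT, Finset.sum_filter]; exact hul
    rw [Finset.sum_add_distrib, Finset.sum_const, hs, nsmul_eq_mul]
    have hvl : ∑ i ∈ s, v i ≤ l := hvsum ▸ Finset.sum_le_univ_sum_of_nonneg hv0
    have hrM : (r : ℝ) ≤ M := by exact_mod_cast min_le_right _ _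
    rcases le_or_gt r T.card with hrT | hrT
    · obtain ⟨T', hT'sub, hT'card⟩ := Finset.exists_subset_card_eq hrT
      have h1 : r * σ ≤ ∑ i ∈ T', u i := by
        calc (r : ℝ) * σ = ∑ i ∈ T', σ := by simp [hT'card]
          _ ≤ _ := Finset.sum_le_sum fun i hi => (Finset.mem_filter.1 (hT'sub hi)).2
      have h2 := sum_le_headSum hu.1 (hT'card.trans_le (min_le_left k M))
      have h4 : ∑ i ∈ s, v i ≤ r * τ := by
        calc ∑ i ∈ s, v i ≤ ∑ i ∈ s, τ := Finset.sum_le_sum fun i _ => hvτ i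
          _ = r * τ := by simp [hs]
      have h5 : (r : ℝ) * (τ + (1 - l) / M) ≤ r * σ :=
        mul_le_mul_of_nonneg_left (by linarith) (Nat.cast_nonneg r)
      linarith
    · rw [hsum']
      refine le_trans (add_le_add_left hvl _) ?_
      rcases le_total ((1 - l) / M) θ with hθ | hθ
      · have hTs : T ⊆ s' := by
          intro i hi
          by_contra his
          have : s' ⊆ T := fun j hj => Finset.mem_filter.2
            ⟨Finset.mem_univ _, (Finset.mem_filter.1 hi).2.trans ((hout i his).trans (hin j hj))⟩
          exact absurd (Finset.card_le_card this) (by omega)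
        have h1 : ∑ i ∈ T, (u i - (1 - l) / M) ≤ ∑ i ∈ s', (u i - (1 - l) / M) :=
          Finset.sum_le_sum_of_subset_of_nonneg hTs fun i hi _ =>
            sub_nonneg.2 (hθ.trans (hin i hi))
        have hTcard : T.card * ((1 - l) / M) ≤ 1 / (σ * M) := by
          have : (T.card : ℝ) ≤ 1 / σ := by
            rw [le_div_iff₀ hσ]
            exact hu.card_mul_le fun i hi => (Finset.mem_filter.1 hi).2
          calc _ ≤ 1 / σ * (1 / M) := mul_le_mul this hr1 hr0 (by positivity)
            _ = _ := by rw [one_div_mul_one_div]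
        simp only [Finset.sum_sub_distrib, Finset.sum_const, nsmul_eq_mul, hs'] at h1
        linarith
      · have h1 : ∑ i ∈ s'ᶜ, u i ≤ (M - r) * ((1 - l) / M) := by
          calc ∑ i ∈ s'ᶜ, u i ≤ ∑ i ∈ s'ᶜ, (1 - l) / M :=
                Finset.sum_le_sum fun i hi => (hout i (Finset.mem_compl.1 hi)).trans hθ
            _ = _ := by
              rw [Finset.sum_const, Finset.card_compl, hα, hs', nsmul_eq_mul,
                Nat.cast_sub (min_le_right _ _)]
        have h2 := Finset.sum_add_sum_compl s' u
        rw [hu.2] at h2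
        have h3 : (M : ℝ) * ((1 - l) / M) = 1 - l := by field_simp
        linarith
  · have h1 : l ≤ ∑ i, min (w i) (v i + (1 - l) / M) := by
      calc l = ∑ i, v i := hvsum.symm
        _ ≤ _ := Finset.sum_le_sum fun i _ => le_min (hvw i) (by linarith)
    rw [← one_sub_tvd hw.2 hb.2] at h1
    linarith

end Majorisation

/-- The logarithm of the likelihood ratio of `a` and the uniform distribution on `N` outcomes. -/
def logRatio {α : Type*} (N : ℕ) (a : α → ℝ) : α → ℝ := fun i => Real.log (N * a i)

lemma tpow_mul_pow_eq_exp {α : Type*} {N : ℕ} {a : α → ℝ} (ha : ∀ i, 0 ≤ a i) (hN : 0 < N) {n : ℕ} {x : Fin n → α}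
    (hx : tpow a n x ≠ 0) : tpow a n x * (N : ℝ) ^ n = exp (∑ j, logRatio N a (x j)) := by
  have h : ∀ j, exp (logRatio N a (x j)) = a (x j) * N := by
    intro j
    have h0 : 0 < a (x j) := (ha _).lt_of_ne' (Finset.prod_ne_zero_iff.1 hx j (Finset.mem_univ j))
    rw [logRatio, Real.exp_log (by positivity), mul_comm]
  simp [Real.exp_sum, h, Finset.prod_mul_distrib, tpow]

section Products

variable {α β : Type*} [Fintype α] [Fintype β] {N : ℕ}

lemma IsProbDist.tpow {a : α → ℝ} (ha : IsProbDist a) (n : ℕ) : IsProbDist (tpow a n) :=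
  ⟨tpow_nonneg ha.1 n, by rw [sum_tpow, ha.2, one_pow]⟩

lemma IsProbDist.tensor {a : α → ℝ} {b : β → ℝ} (ha : IsProbDist a) (hb : IsProbDist b) :
    IsProbDist (tensor a b) := by
  refine ⟨fun x => mul_nonneg (ha.1 _) (hb.1 _), ?_⟩
  simp only [_root_.tensor, Fintype.sum_prod_type, ← Finset.mul_sum, hb.2, mul_one, ha.2]

lemma isProbDist_unif (hN : 0 < N) : IsProbDist (unif N) := by
  have : (N : ℝ) ≠ 0 := by positivity
  refine ⟨fun i => by simp [unif], ?_⟩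
  simp [unif, this]

/-- Sums of truncations of `a ^ ⊗n ⊗ η_N ^ ⊗m` reduce to sums over the first factor. -/
lemma sum_ite_tensor_unif (a : α → ℝ) (hN : 0 < N) (n m : ℕ) (P : ℝ → Prop) [DecidablePred P] :
    (∑ z, if P (tensor (tpow a n) (tpow (unif N) m) z)
        then tensor (tpow a n) (tpow (unif N) m) z else 0) =
      ∑ x, if P (tpow a n x / (N : ℝ) ^ m) then tpow a n x else 0 := by
  have hN' : (N : ℝ) ≠ 0 := by positivity
  rw [Fintype.sum_prod_type]
  refine Finset.sum_congr rfl fun x _ => ?_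
  have : ∀ y : Fin m → Fin N,
      tensor (tpow a n) (tpow (unif N) m) (x, y) = tpow a n x / (N : ℝ) ^ m := by
    intro y
    simp [tensor, tpow, unif, div_eq_mul_inv]
  simp only [this, Finset.sum_const, Finset.card_univ, Fintype.card_pi, Fintype.card_fin,
    Finset.prod_const, nsmul_eq_mul, Nat.cast_pow]
  split_ifs
  · field_simp
  · simp

lemma sum_ite_le_tensor {a : α → ℝ} (ha : ∀ i, 0 ≤ a i) (hN : 0 < N) (n m : ℕ) (ℓ : ℝ) :
    (∑ z, if exp ℓ / (N : ℝ) ^ (n + m) ≤ tensor (tpow a n) (tpow (unif N) m) z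
        then tensor (tpow a n) (tpow (unif N) m) z else 0) = upperTail a (logRatio N a) n ℓ := by
  have hN' : (0 : ℝ) < N := by positivity
  rw [sum_ite_tensor_unif a hN n m fun v => exp ℓ / (N : ℝ) ^ (n + m) ≤ v]
  refine Finset.sum_congr rfl fun x _ => ?_
  by_cases hx : tpow a n x = 0
  · simp [hx]
  · refine if_congr ?_ rfl rfl
    rw [← Real.exp_le_exp (x := ℓ), ← tpow_mul_pow_eq_exp ha hN hx, pow_add, ← div_div,
      div_le_div_iff_of_pos_right (by positivity), div_le_iff₀ (by positivity)]

lemma sum_tensor_le_ite {a : α → ℝ} (ha : ∀ i, 0 ≤ a i) (hN : 0 < N) (n m : ℕ) (ℓ : ℝ) :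
    (∑ z, if tensor (tpow a n) (tpow (unif N) m) z ≤ exp ℓ / (N : ℝ) ^ (n + m)
        then tensor (tpow a n) (tpow (unif N) m) z else 0)
      = upperTail a (fun i => -logRatio N a i) n (-ℓ) := by
  have hN' : (0 : ℝ) < N := by positivity
  rw [sum_ite_tensor_unif a hN n m fun v => v ≤ exp ℓ / (N : ℝ) ^ (n + m)]
  refine Finset.sum_congr rfl fun x _ => ?_
  by_cases hx : tpow a n x = 0
  · simp [hx]
  · refine if_congr ?_ rfl rfl
    rw [Finset.sum_neg_distrib, neg_le_neg_iff, ← Real.exp_le_exp (y := ℓ),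
      ← tpow_mul_pow_eq_exp ha hN hx, pow_add, ← div_div,
      div_le_div_iff_of_pos_right (by positivity), le_div_iff₀ (by positivity)]

/-- The condition defining the conversion rate. -/
def Convertible (N : ℕ) (a : α → ℝ) (b : β → ℝ) (n m : ℕ) (ε : ℝ) : Prop :=
  ApproxMajTV (tensor (tpow a n) (tpow (unif N) m)) (tensor (tpow b m) (tpow (unif N) n)) ε

lemma Convertible.one_sub_le {a : α → ℝ} {b : β → ℝ} (ha : IsProbDist a) (hb : IsProbDist b)
    (hN : 0 < N) {n m : ℕ} {ε : ℝ} (h : Convertible N a b n m ε) (ℓ ℓ' : ℝ) :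
    1 - ε ≤ upperTail a (logRatio N a) n ℓ + upperTail b (fun i => -logRatio N b i) m (-ℓ')
      + exp (ℓ - ℓ') := by
  have hN' : (0 : ℝ) < N := by positivity
  have hη := isProbDist_unif hN
  have := ApproxMajTV.one_sub_le h ((ha.tpow n).tensor (hη.tpow m))
    ((hb.tpow m).tensor (hη.tpow n)) (σ := exp ℓ / (N : ℝ) ^ (n + m))
    (τ := exp ℓ' / (N : ℝ) ^ (m + n)) (by positivity) (by positivity)
  rw [sum_ite_le_tensor ha.1 hN, sum_tensor_le_ite hb.1 hN, add_comm m n,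
    div_div_div_cancel_right₀ (by positivity), ← Real.exp_sub] at this
  exact this

lemma convertible_of_le {a : α → ℝ} {b : β → ℝ} (ha : IsProbDist a) (hb : IsProbDist b)
    (hN : 0 < N) (hα : Fintype.card α = N) (hβ : Fintype.card β = N) {n m : ℕ} {l ℓ ℓ' : ℝ}
    (hl : 0 < l) (hl1 : l ≤ 1) (hℓ : exp ℓ' + 1 ≤ exp ℓ)
    (hb' : l ≤ upperTail b (fun i => -logRatio N b i) m (-ℓ'))
    (ha' : l + exp (-ℓ) ≤ upperTail a (logRatio N a) n ℓ) :
    Convertible N a b n m (1 - l) := by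
  have hN' : (0 : ℝ) < N := by positivity
  have hη := isProbDist_unif hN
  refine approxMajTV_of_le (M := N ^ (n + m)) (σ := exp ℓ / (N : ℝ) ^ (n + m))
    (τ := exp ℓ' / (N : ℝ) ^ (n + m)) ((ha.tpow n).tensor (hη.tpow m))
    ((hb.tpow m).tensor (hη.tpow n)) ?_ ?_ (by positivity) hl hl1 (by positivity) ?_ ?_ ?_
  · simp [hα, pow_add]
  · simp [hβ, pow_add, mul_comm]
  · rw [Nat.cast_pow, ← add_div]
    exact div_le_div_of_nonneg_right hℓ (by positivity)
  · rw [add_comm n m, sum_tensor_le_ite hb.1 hN]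
    exact hb'
  · rw [sum_ite_le_tensor ha.1 hN, Nat.cast_pow, div_mul_cancel₀ _ (by positivity), one_div,
      ← Real.exp_neg]
    exact ha'

end Products

section Rate

lemma ModerateSeq.eventually_pos {t : ℕ → ℝ} (ht : ModerateSeq t) : ∀ᶠ n in atTop, 0 < t n := by
  filter_upwards [ht.2.eventually_gt_atTop 0] with n hn
  exact pos_of_mul_pos_right hn (Real.sqrt_nonneg _)

lemma ModerateSeq.tendsto_mul_sq {t : ℕ → ℝ} (ht : ModerateSeq t) :
    Tendsto (fun n : ℕ => (n : ℝ) * t n ^ 2) atTop atTop := by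
  refine (ht.2.atTop_mul_atTop₀ ht.2).congr fun n => ?_
  linear_combination t n ^ 2 * Real.mul_self_sqrt (Nat.cast_nonneg (α := ℝ) n)

lemma ModerateSeq.tendsto_mul {t : ℕ → ℝ} (ht : ModerateSeq t) :
    Tendsto (fun n : ℕ => (n : ℝ) * t n) atTop atTop := by
  refine tendsto_atTop_mono' _ ?_ ht.tendsto_mul_sq
  filter_upwards [ht.1.eventually_le_const one_pos, ht.eventually_pos] with n h1 h0
  have : t n ^ 2 ≤ t n := by nlinarith
  exact mul_le_mul_of_nonneg_left this (Nat.cast_nonneg n)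

variable {α β : Type*} [Fintype α] [Fintype β] {N : ℕ} {a : α → ℝ} {b : β → ℝ}
  {Da Db Va Vb A B κ : ℝ} {t : ℕ → ℝ}

lemma eventually_not_convertible (ha : IsProbDist a) (hb : IsProbDist b) (hN : 0 < N)
    (hDa : ∑ i, a i * logRatio N a i = Da) (hDb : ∑ i, b i * logRatio N b i = Db)
    (hVa : ∑ i, a i * (logRatio N a i - Da) ^ 2 = Va)
    (hVb : ∑ i, b i * (logRatio N b i - Db) ^ 2 = Vb)
    (hDa0 : 0 < Da) (hDb0 : 0 < Db) (hVa0 : 0 < Va) (hVb0 : 0 < Vb)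
    (ht : ModerateSeq t) (hA : 0 < A) (hA2 : A ^ 2 = 2 * Va)
    (hB : 0 < B) (hB2 : B ^ 2 = 2 * Vb * Da / Db) (hκ : 0 < κ) :
    ∀ᶠ n : ℕ in atTop, ∀ m : ℕ, n * Da + (A + B + 3 * κ) * (n * t n) ≤ m * Db →
      ¬ Convertible N a b n m (1 - exp (-(n * t n ^ 2))) := by
  have hcA : 2 * Va < (A + κ / 2) ^ 2 := by rw [← hA2]; nlinarith
  have hcB : 2 * Vb < (B + κ / 2) ^ 2 * Db / Da := by
    rw [lt_div_iff₀ hDa0, ← div_lt_iff₀ hDb0, ← hB2]; nlinarith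
  obtain ⟨zA, hzA, hPA⟩ := upperTail_le_exp ha hDa hVa hVa0 hcA
  obtain ⟨zB, hzB, hPB⟩ := upperTail_le_exp (X := fun i => -logRatio N b i) hb
    (μ := -Db) (by simp [hDb]) (V := Vb) (by rw [← hVb]; exact Finset.sum_congr rfl fun i _ => by ring)
    hVb0 hcB
  set ρA := ((A + κ) / (A + κ / 2)) ^ 2 with hρA
  set ρB := (B + κ) / (B + κ / 2) with hρB
  have hρA1 : 1 < ρA := one_lt_pow₀ ((one_lt_div (by positivity)).2 (by linarith)) two_ne_zero
  have hρB1 : 1 < ρB := (one_lt_div (by positivity)).2 (by linarith)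
  have hw := ht.tendsto_mul_sq
  have lim : ∀ C : ℝ, Tendsto (fun n => C * t n) atTop (𝓝 0) := fun C => by
    simpa using ht.1.const_mul C
  filter_upwards [ht.eventually_pos, ht.1.eventually_le_const (half_pos hκ),
    (lim (A + κ)).eventually_le_const hzA,
    (lim ((B + κ) * Db / Da)).eventually_le_const hzB,
    (lim (A + B + 3 * κ)).eventually_le_const (show 0 < (ρB - 1) * Da by
      exact mul_pos (by linarith) hDa0),
    hw.eventually_gt_atTop (Real.log 3 / (ρA - 1)), hw.eventually_gt_atTop (Real.log 3 / (ρB - 1)),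
    hw.eventually_gt_atTop (Real.log 3)] with n ht0 htκ hzA' hzB' hρ hwA hwB hw1 m hm hconv
  have hn : (0 : ℝ) ≤ n := Nat.cast_nonneg n
  set τ := t n
  set w := n * τ ^ 2 with hw_def
  have hsmall : ∀ x, x < -w - Real.log 3 → exp x < exp (-w) / 3 := by
    intro x hx
    have := Real.exp_lt_exp.2 hx
    rwa [Real.exp_sub, Real.exp_log (by norm_num)] at this
  have hmain := hconv.one_sub_le ha hb hN (n * Da + (A + κ) * (n * τ)) (n * Da + (A + 2 * κ) * (n * τ))
  have h1 : upperTail a (logRatio N a) n (n * Da + (A + κ) * (n * τ)) < exp (-w) / 3 := by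
    have := hPA n ((A + κ) * τ) (by positivity) hzA'
    rw [show n * (Da + (A + κ) * τ) = n * Da + (A + κ) * (n * τ) by ring] at this
    refine this.trans_lt (hsmall _ ?_)
    have e : n * ((A + κ) * τ) ^ 2 / (A + κ / 2) ^ 2 = w * ρA := by
      rw [hρA, hw_def, div_pow]; ring
    rw [div_lt_iff₀ (by linarith)] at hwA
    rw [e]; linarith
  have h2 : upperTail b (fun i => -logRatio N b i) m (-(n * Da + (A + 2 * κ) * (n * τ)))
      < exp (-w) / 3 := by
    set D' := Da + (A + B + 3 * κ) * τ with hD'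
    have hD'a : Da ≤ D' := le_add_of_nonneg_right (by positivity)
    have hD'0 : 0 < D' := by linarith
    have hmD : n * D' / Db ≤ m := by rw [div_le_iff₀ hDb0]; linarith
    set z := (B + κ) * τ * Db / D' with hz
    have hz0 : 0 ≤ z := by positivity
    have hzzB : z ≤ zB := by
      refine le_trans ?_ hzB'
      rw [hz, show (B + κ) * Db / Da * τ = (B + κ) * τ * Db / Da by ring]
      exact div_le_div_of_nonneg_left (by positivity) hDa0 hD'a
    have hzDb : z ≤ Db := by
      rw [hz, div_le_iff₀ hD'0, mul_comm Db]
      refine mul_le_mul_of_nonneg_right ?_ hDb0.le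
      rw [hD']; nlinarith [mul_pos hA ht0, mul_pos hκ ht0]
    have hle : (m : ℝ) * (-Db + z) ≤ -(n * Da + (A + 2 * κ) * (n * τ)) := by
      have h := mul_le_mul_of_nonneg_right hmD (sub_nonneg.2 hzDb)
      have e : n * D' / Db * (Db - z) = n * Da + (A + 2 * κ) * (n * τ) := by
        rw [hz]; field_simp; rw [hD']; ring
      linarith
    refine (upperTail_antitone hb.1 m hle).trans_lt ((hPB m z hz0 hzzB).trans_lt (hsmall _ ?_))
    have h3 : w * ρB ≤ m * z ^ 2 / ((B + κ / 2) ^ 2 * Db / Da) := by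
      have hD'ρ : D' ≤ ρB * Da := by linarith
      calc w * ρB ≤ w * ρB * (ρB * Da / D') :=
            le_mul_of_one_le_right (by positivity) ((one_le_div hD'0).2 hD'ρ)
        _ = n * D' / Db * z ^ 2 / ((B + κ / 2) ^ 2 * Db / Da) := by
            rw [hz, hρB, hw_def]; field_simp
        _ ≤ _ := by gcongr
    rw [div_lt_iff₀ (by linarith)] at hwB
    linarith
  have h3 : exp (n * Da + (A + κ) * (n * τ) - (n * Da + (A + 2 * κ) * (n * τ))) < exp (-w) / 3 := by
    refine hsmall _ ?_
    have : n * τ * τ ≤ n * τ * (κ / 2) := mul_le_mul_of_nonneg_left htκ (by positivity)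
    have e : w = n * τ * τ := by rw [hw_def]; ring
    linarith
  linarith

lemma eventually_convertible (ha : IsProbDist a) (hb : IsProbDist b) (hN : 0 < N)
    (hα : Fintype.card α = N) (hβ : Fintype.card β = N)
    (hDa : ∑ i, a i * logRatio N a i = Da) (hDb : ∑ i, b i * logRatio N b i = Db)
    (hVa : ∑ i, a i * (logRatio N a i - Da) ^ 2 = Va)
    (hVb : ∑ i, b i * (logRatio N b i - Db) ^ 2 = Vb)
    (hDa0 : 0 < Da) (hDb0 : 0 < Db)
    (ht : ModerateSeq t) (hA2 : A ^ 2 = 2 * Va) (hB2 : B ^ 2 = 2 * Vb * Da / Db) (hκ : 0 < κ)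
    (hκA : 2 * κ < A) (hκB : 2 * κ < B) :
    ∀ᶠ n : ℕ in atTop, ∀ m : ℕ, n * Da ≤ m * Db →
      m * Db ≤ n * Da + (A + B - 4 * κ) * (n * t n) →
      Convertible N a b n m (1 - exp (-(n * t n ^ 2))) := by
  have hcA : (A - κ / 2) ^ 2 < 2 * Va := by rw [← hA2]; nlinarith
  have hcB : (B - κ) ^ 2 * Db / Da < 2 * Vb := by
    rw [div_lt_iff₀ hDa0, ← lt_div_iff₀ hDb0, ← hB2]; nlinarith
  have hAκ : 0 < A - κ / 2 := by linarith
  have hAκ' : 0 < A - κ := by linarith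
  have hBκ : 0 < B - κ := by linarith
  have hBκ' : 0 < B - 2 * κ := by linarith
  obtain ⟨zA, hzA, KA, hPA⟩ := exp_le_upperTail ha hDa hVa (by positivity) hcA
  obtain ⟨zB, hzB, KB, hPB⟩ := exp_le_upperTail (X := fun i => -logRatio N b i) hb
    (μ := -Db) (by simp [hDb]) (V := Vb) (by rw [← hVb]; exact Finset.sum_congr rfl fun i _ => by ring)
    (by positivity) hcB
  set ρA := ((A - κ) / (A - κ / 2)) ^ 2 with hρA
  have hρA1 : ρA < 1 :=
    pow_lt_one₀ (by positivity) ((div_lt_one (by positivity)).2 (by linarith)) two_ne_zero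
  have hw := ht.tendsto_mul_sq
  have lim : ∀ C : ℝ, Tendsto (fun n => C * t n) atTop (𝓝 0) := fun C => by
    simpa using ht.1.const_mul C
  filter_upwards [ht.eventually_pos, (ht.1.pow 2).eventually_le_const (by simpa using hDa0),
    (lim (A - κ)).eventually_le_const hzA,
    (lim ((B - 2 * κ) * Db / Da)).eventually_le_const hzB,
    (lim (A + B - 4 * κ)).eventually_le_const hDa0,
    hw.eventually_ge_atTop (Real.log 2 / (1 - ρA)),
    hw.eventually_ge_atTop (KA / (A - κ) ^ 2),
    hw.eventually_ge_atTop (KB / ((B - 2 * κ) ^ 2 * Db / (2 * Da))),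
    ht.tendsto_mul.eventually_ge_atTop (Real.log 2 / κ), eventually_gt_atTop 0]
    with n ht0 ht2 hzA' hzB' hr hwA hKA hKB hnt hn0 m hm1 hm2
  have hn : (0 : ℝ) < n := by exact_mod_cast hn0
  set τ := t n
  set w := n * τ ^ 2 with hw_def
  have hw0 : 0 ≤ w := by positivity
  have hm : (0 : ℝ) < m := pos_of_mul_pos_left ((mul_pos hn hDa0).trans_le hm1) hDb0.le
  refine convertible_of_le ha hb hN hα hβ (ℓ := n * Da + (A - κ) * (n * τ))
    (ℓ' := n * Da + (A - 2 * κ) * (n * τ)) (Real.exp_pos _) (Real.exp_le_one_iff.2 (by linarith))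
    ?_ ?_ ?_
  · have h0 : 1 ≤ exp (n * Da + (A - 2 * κ) * (n * τ)) := by
      have : 0 < A - 2 * κ := by linarith
      exact Real.one_le_exp (by positivity)
    rw [div_le_iff₀ hκ] at hnt
    calc _ ≤ exp (n * Da + (A - 2 * κ) * (n * τ)) * 2 := by linarith
      _ = exp (n * Da + (A - 2 * κ) * (n * τ) + Real.log 2) := by
          rw [Real.exp_add _ (Real.log 2), Real.exp_log two_pos]
      _ ≤ _ := Real.exp_le_exp.2 (by linarith)
  · set z := (B - 2 * κ) * (n * τ) / m with hz
    have hz0 : 0 ≤ z := by positivity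
    have hmz : m * z = (B - 2 * κ) * (n * τ) := by rw [hz]; field_simp
    have hzle : z ≤ (B - 2 * κ) * Db / Da * τ := by
      rw [hz, div_le_iff₀ hm]
      calc (B - 2 * κ) * (n * τ) = (B - 2 * κ) * τ / Da * (n * Da) := by field_simp
        _ ≤ (B - 2 * κ) * τ / Da * (m * Db) := by gcongr
        _ = _ := by ring
    have hmz2 : m * z ^ 2 = (B - 2 * κ) * (n * τ) * z := by rw [← hmz]; ring
    have hK : KB ≤ m * z ^ 2 := by
      rw [div_le_iff₀ (by positivity)] at hKB
      refine hKB.trans ?_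
      rw [hmz2]
      have hm3 : m * Db ≤ 2 * (n * Da) := by
        have := mul_le_mul_of_nonneg_left hr hn.le
        linarith
      have : (B - 2 * κ) * Db / (2 * Da) * τ ≤ z := by
        rw [hz, le_div_iff₀ hm]
        calc _ = (B - 2 * κ) * τ / (2 * Da) * (m * Db) := by ring
          _ ≤ (B - 2 * κ) * τ / (2 * Da) * (2 * (n * Da)) := by gcongr
          _ = _ := by field_simp
      calc _ = (B - 2 * κ) * (n * τ) * ((B - 2 * κ) * Db / (2 * Da) * τ) := by rw [hw_def]; ring
        _ ≤ _ := by gcongr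
    have hle : -(n * Da + (A - 2 * κ) * (n * τ)) ≤ m * (-Db + z) := by
      rw [mul_add, hmz]; linarith
    refine le_trans ?_ ((hPB m z hz0 (hzle.trans hzB') hK).trans (upperTail_antitone hb.1 m hle))
    refine Real.exp_le_exp.2 (neg_le_neg ?_)
    rw [div_le_iff₀ (by positivity), hmz2]
    calc _ ≤ (B - 2 * κ) * (n * τ) * ((B - 2 * κ) * Db / Da * τ) := by gcongr
      _ = w * ((B - 2 * κ) ^ 2 * Db / Da) := by rw [hw_def]; ring
      _ ≤ _ := by gcongr; linarith
  · have h := hPA n ((A - κ) * τ) (by positivity) hzA' (by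
      rw [div_le_iff₀ (by positivity)] at hKA
      calc KA ≤ w * (A - κ) ^ 2 := hKA
        _ = _ := by rw [hw_def]; ring)
    rw [show n * (Da + (A - κ) * τ) = n * Da + (A - κ) * (n * τ) by ring] at h
    refine le_trans ?_ h
    have e : n * ((A - κ) * τ) ^ 2 / (A - κ / 2) ^ 2 = w * ρA := by
      rw [hρA, hw_def, div_pow]; ring
    rw [e]
    have h1 : exp (-(n * Da + (A - κ) * (n * τ))) ≤ exp (-w) := by
      refine Real.exp_le_exp.2 (neg_le_neg ?_)
      have := mul_le_mul_of_nonneg_left ht2 hn.le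
      have : 0 ≤ (A - κ) * (n * τ) := by positivity
      linarith
    rw [div_le_iff₀ (by linarith)] at hwA
    calc _ ≤ exp (-w) * 2 := by linarith
      _ = exp (-w + Real.log 2) := by rw [Real.exp_add _ (Real.log 2), Real.exp_log two_pos]
      _ ≤ _ := Real.exp_le_exp.2 (by linarith)

/-- The conversion rate in terms of two distributions on `N` outcomes. -/
lemma tendsto_rate (ha : IsProbDist a) (hb : IsProbDist b) (hN : 0 < N)
    (hα : Fintype.card α = N) (hβ : Fintype.card β = N)
    (hDa : ∑ i, a i * logRatio N a i = Da) (hDb : ∑ i, b i * logRatio N b i = Db)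
    (hVa : ∑ i, a i * (logRatio N a i - Da) ^ 2 = Va)
    (hVb : ∑ i, b i * (logRatio N b i - Db) ^ 2 = Vb)
    (hDa0 : 0 < Da) (hDb0 : 0 < Db) (hVa0 : 0 < Va) (hVb0 : 0 < Vb)
    (ht : ModerateSeq t) (hA : 0 < A) (hA2 : A ^ 2 = 2 * Va)
    (hB : 0 < B) (hB2 : B ^ 2 = 2 * Vb * Da / Db) :
    Tendsto (fun n : ℕ =>
      ((sSup {m : ℕ | Convertible N a b n m (1 - exp (-(n * t n ^ 2)))} : ℕ) / (n : ℝ)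
        - Da / Db) / t n) atTop (𝓝 ((A + B) / Db)) := by
  refine tendsto_order.2 ⟨fun x hx => ?_, fun x hx => ?_⟩
  · rw [lt_div_iff₀ hDb0] at hx
    obtain ⟨κ, hκ, hκm⟩ := exists_between
      (show 0 < min ((A + B - x * Db) / 5) (min (A / 2) (B / 2)) by
        have : 0 < A + B - x * Db := by linarith
        positivity)
    simp only [lt_min_iff] at hκm
    filter_upwards [eventually_not_convertible ha hb hN hDa hDb hVa hVb hDa0 hDb0 hVa0 hVb0 ht hA
        hA2 hB hB2 one_pos,
      eventually_convertible ha hb hN hα hβ hDa hDb hVa hVb hDa0 hDb0 ht hA2 hB2 hκ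
        (by linarith) (by linarith), ht.eventually_pos,
      ht.tendsto_mul.eventually_gt_atTop (Db / κ),
      ht.tendsto_mul.eventually_ge_atTop (Db / (A + B - 4 * κ)), eventually_gt_atTop 0]
      with n hbdd hconv ht0 hntκ hnt hn0
    have hn : (0 : ℝ) < n := by exact_mod_cast hn0
    rw [div_lt_iff₀ hκ] at hntκ
    rw [div_le_iff₀ (by linarith)] at hnt
    set y := (n * Da + (A + B - 4 * κ) * (n * t n)) / Db with hy
    have hy0 : 0 ≤ y := by
      have : 0 < A + B - 4 * κ := by linarith
      positivity
    have hyDb : y * Db = n * Da + (A + B - 4 * κ) * (n * t n) := by rw [hy]; field_simp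
    have h1 := Nat.floor_le hy0
    have h2 := Nat.lt_floor_add_one y
    have hmem := hconv ⌊y⌋₊ (by nlinarith) (by nlinarith)
    have hBdd : BddAbove {m : ℕ | Convertible N a b n m (1 - exp (-(n * t n ^ 2)))} := by
      refine ⟨⌈(n * Da + (A + B + 3 * 1) * (n * t n)) / Db⌉₊, fun m hm => ?_⟩
      by_contra! h
      refine hbdd m ?_ hm
      rw [← div_le_iff₀ hDb0]
      exact Nat.ceil_le.1 h.le
    have h3 : (⌊y⌋₊ : ℝ) ≤ sSup {m : ℕ | Convertible N a b n m (1 - exp (-(n * t n ^ 2)))} := by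
      exact_mod_cast le_csSup hBdd hmem
    rw [lt_div_iff₀ ht0, lt_sub_iff_add_lt, lt_div_iff₀ hn]
    refine lt_of_lt_of_le ?_ h3
    have h4 : (x * t n + Da / Db) * n * Db < (y - 1) * Db := by
      have e : (x * t n + Da / Db) * n * Db = x * Db * (n * t n) + n * Da := by field_simp
      have : 0 < n * t n := by positivity
      rw [e]
      nlinarith [mul_pos (show 0 < A + B - x * Db - 5 * κ by linarith) this]
    have := lt_of_mul_lt_mul_right h4 hDb0.le
    linarith
  · rw [gt_iff_lt, div_lt_iff₀ hDb0] at hx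
    set κ := (x * Db - (A + B)) / 3 with hκ
    have hκ0 : 0 < κ := by rw [hκ]; linarith
    filter_upwards [eventually_not_convertible ha hb hN hDa hDb hVa hVb hDa0 hDb0 hVa0 hVb0 ht hA
        hA2 hB hB2 hκ0, ht.eventually_pos, eventually_gt_atTop 0] with n hnot ht0 hn0
    have hn : (0 : ℝ) < n := by exact_mod_cast hn0
    set S := {m : ℕ | Convertible N a b n m (1 - exp (-(n * t n ^ 2)))} with hS
    have hlt : ∀ m ∈ S, (m : ℝ) * Db < n * Da + x * Db * (n * t n) := by
      intro m hm
      by_contra! h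
      exact hnot m (by rw [hκ]; linarith) hm
    have hsup : ((sSup S : ℕ) : ℝ) * Db < n * Da + x * Db * (n * t n) := by
      rcases S.eq_empty_or_nonempty with h | h
      · have : 0 < x := pos_of_mul_pos_left (by linarith : 0 < x * Db) hDb0.le
        rw [h, csSup_empty, Nat.bot_eq_zero]
        simp only [Nat.cast_zero, zero_mul]
        positivity
      · refine hlt _ (Nat.sSup_mem h ⟨⌈(n * Da + x * Db * (n * t n)) / Db⌉₊, fun m hm => ?_⟩)
        have := (lt_div_iff₀ hDb0).2 (hlt m hm)
        exact_mod_cast this.le.trans (Nat.le_ceil _)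
    rw [div_lt_iff₀ ht0, sub_lt_iff_lt_add, div_lt_iff₀ hn]
    refine lt_of_mul_lt_mul_right (hsup.trans_eq ?_) hDb0.le
    field_simp
    ring

end Rate

section Embedding

variable {d N : ℕ} {c : Fin d → ℕ}

/-- Summing a function of the outcome against the embedded distribution. -/
lemma sum_embed_mul (hc : ∀ i, 0 < c i) (p f : Fin d → ℝ) :
    ∑ x, embed c p x * f x.1 = ∑ i, p i * f i := by
  rw [Fintype.sum_sigma]
  refine Finset.sum_congr rfl fun i _ => ?_
  have : (c i : ℝ) ≠ 0 := by exact_mod_cast (hc i).ne'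
  simp only [embed, Finset.sum_const, Finset.card_univ, Fintype.card_fin, nsmul_eq_mul]
  field_simp

lemma IsProbDist.embed {p : Fin d → ℝ} (hp : IsProbDist p) (hc : ∀ i, 0 < c i) :
    IsProbDist (embed c p) := by
  refine ⟨fun x => div_nonneg (hp.1 _) (Nat.cast_nonneg _), ?_⟩
  simpa [hp.2] using sum_embed_mul hc p fun _ => 1

lemma logRatio_embed {γ : Fin d → ℝ} (hγ : ∀ i, γ i = (c i : ℝ) / (N : ℝ)) (p : Fin d → ℝ)
    (x : Σ i, Fin (c i)) : logRatio N (_root_.embed c p) x = Real.log (p x.1 / γ x.1) := by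
  rw [logRatio, _root_.embed, hγ, div_div_eq_mul_div, mul_comm (p _), mul_div_assoc]

lemma sum_embed_mul_logRatio (hc : ∀ i, 0 < c i) {γ : Fin d → ℝ}
    (hγ : ∀ i, γ i = (c i : ℝ) / (N : ℝ)) (p : Fin d → ℝ) :
    ∑ x, embed c p x * logRatio N (embed c p) x = relD p γ := by
  simp only [logRatio_embed hγ]
  exact sum_embed_mul hc p fun i => Real.log (p i / γ i)

lemma sum_embed_mul_logRatio_sq (hc : ∀ i, 0 < c i) {γ : Fin d → ℝ}
    (hγ : ∀ i, γ i = (c i : ℝ) / (N : ℝ)) (p : Fin d → ℝ) :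
    ∑ x, embed c p x * (logRatio N (embed c p) x - relD p γ) ^ 2 = relV p γ := by
  simp only [logRatio_embed hγ]
  exact sum_embed_mul hc p fun i => (Real.log (p i / γ i) - relD p γ) ^ 2

end Embedding

/-- Moderate deviation expansion of the optimal thermodynamic-direction conversion rate
in the converse regime (total variation error `ε_n = 1 - e^{-n t_n²}`). -/
theorem thermodynamic_direction_converse
    {d N : ℕ} (c : Fin d → ℕ) (hcpos : ∀ i, 0 < c i) (hcN : ∑ i, c i = N)
    (γ : Fin d → ℝ) (hγprob : IsProbDist γ) (hγ : ∀ i, γ i = (c i : ℝ) / (N : ℝ))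
    (p q : Fin d → ℝ) (hp : IsProbDist p) (hq : IsProbDist q)
    (hDp : 0 < relD p γ) (hDq : 0 < relD q γ)
    (hVp : 0 < relV p γ) (hVq : 0 < relV q γ)
    (t : ℕ → ℝ) (ht : ModerateSeq t)
    (ε : ℕ → ℝ) (hε : ∀ n : ℕ, ε n = 1 - Real.exp (-((n : ℝ) * t n ^ 2)))
    (R : ℕ → ℝ → ℝ)
    (hR : ∀ n : ℕ, ∀ e : ℝ, 0 ≤ e → R n e =
      (↑(sSup {m : ℕ | ApproxMajTV (tensor (tpow (embed c p) n) (tpow (unif N) m))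
          (tensor (tpow (embed c q) m) (tpow (unif N) n)) e}) : ℝ) / (n : ℝ))
    (ν : ℝ) (hν : ν = (relV p γ / relD p γ) / (relV q γ / relD q γ)) :
    Tendsto (fun n : ℕ => (R n (ε n) - relD p γ / relD q γ) / t n) atTop
      (𝓝 (Real.sqrt (2 * relV p γ) / relD q γ * (1 + 1 / Real.sqrt ν))) := by
  have hcard : Fintype.card (Σ i, Fin (c i)) = N := by simp [hcN]
  have hN : 0 < N := by
    rw [Nat.pos_iff_ne_zero]
    rintro rfl
    simpa [hγ] using hγprob.2
  have hB : 0 < 2 * relV q γ * relD p γ / relD q γ := by positivity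
  have key := tendsto_rate (A := √(2 * relV p γ)) (hp.embed hcpos) (hq.embed hcpos) hN hcard hcard
    (sum_embed_mul_logRatio hcpos hγ p) (sum_embed_mul_logRatio hcpos hγ q)
    (sum_embed_mul_logRatio_sq hcpos hγ p) (sum_embed_mul_logRatio_sq hcpos hγ q)
    hDp hDq hVp hVq ht (Real.sqrt_pos.2 (by positivity)) (Real.sq_sqrt (by positivity))
    (Real.sqrt_pos.2 hB) (Real.sq_sqrt hB.le)
  have hlim : √(2 * relV p γ) / relD q γ * (1 + 1 / √ν) =
      (√(2 * relV p γ) + √(2 * relV q γ * relD p γ / relD q γ)) / relD q γ := by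
    have hdiv : √(2 * relV p γ) / √ν = √(2 * relV q γ * relD p γ / relD q γ) := by
      rw [← Real.sqrt_div (by positivity), hν]
      congr 1
      field_simp
    rw [← hdiv]
    ring
  rw [hlim]
  refine key.congr fun n => ?_
  have hε0 : 0 ≤ ε n := by
    rw [hε, sub_nonneg]
    exact Real.exp_le_one_iff.2 (neg_nonpos.2 (by positivity))
  rw [hR n _ hε0, hε]
  rfl
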